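/- arXiv:1609.05784 — 2 statements merged into one kernel-verified Lean document; each statement's English description precedes it below -/
import Mathlib

section
/- Let α_1, α_2 ∈ R and let (x_n)_{n≥0} be an (α_1, α_2)-orbit in T = R/Z taking infinitely many distinct values, and let K be the closure of {x_n : n ≥ 0}. Then either K − K = T or K has non-empty interior. In either case, the lower box-counting dimension of K is at least 1/2. -/
open Filter Metric Set Pointwise

/-- The smallest number of arcs of length `δ` (closed balls of radius `δ/2`)
needed to cover `A`. -/
noncomputable def coverNum {X : Type*} [PseudoMetricSpace X] (A : Set X) (δ : ℝ) : ℕ :=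
  sInf {n : ℕ | ∃ S : Finset X, S.card = n ∧ A ⊆ ⋃ x ∈ S, Metric.closedBall x (δ / 2)}

/-- Lower box-counting dimension: liminf_{δ→0⁺} log N_δ(A) / log(1/δ). -/
noncomputable def lowerBoxDim {X : Type*} [PseudoMetricSpace X] (A : Set X) : ℝ :=
  Filter.liminf (fun δ : ℝ => Real.log (coverNum A δ) / Real.log (1 / δ))
    (nhdsWithin 0 (Set.Ioi 0))

theorem coverNum_le {X : Type*} [PseudoMetricSpace X] {A : Set X} {δ : ℝ} (S : Finset X)
    (hS : A ⊆ ⋃ x ∈ S, closedBall x (δ / 2)) : coverNum A δ ≤ S.card :=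
  Nat.sInf_le ⟨S, rfl, hS⟩

theorem exists_card_eq_coverNum {X : Type*} [PseudoMetricSpace X] [CompactSpace X] (A : Set X)
    {δ : ℝ} (hδ : 0 < δ) :
    ∃ S : Finset X, S.card = coverNum A δ ∧ A ⊆ ⋃ x ∈ S, closedBall x (δ / 2) := by
  apply Nat.sInf_mem (s := {n : ℕ | ∃ S : Finset X, S.card = n ∧
    A ⊆ ⋃ x ∈ S, Metric.closedBall x (δ / 2)})
  obtain ⟨t, -, ht, hcov⟩ := finite_cover_balls_of_compact (isCompact_univ (X := X)) (half_pos hδ)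
  refine ⟨_, ht.toFinset, rfl, fun a _ => ?_⟩
  have := hcov (mem_univ a)
  simp only [mem_iUnion, Finite.mem_toFinset, exists_prop] at this ⊢
  obtain ⟨i, hi, hai⟩ := this
  exact ⟨i, hi, ball_subset_closedBall hai⟩

theorem coverNum_addCircle_le (A : Set (AddCircle (1 : ℝ))) {δ : ℝ} (hδ : 0 < δ) (hδ1 : δ ≤ 1) :
    (coverNum A δ : ℝ) ≤ 3 / δ := by
  set n : ℕ := ⌈2 / δ⌉₊
  have hn0 : 2 / δ ≤ n := Nat.le_ceil _
  have hnpos : (0 : ℝ) < n := lt_of_lt_of_le (by positivity) hn0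
  have hn1 : (n : ℝ) ≤ 3 / δ := by
    have h1 : (n : ℝ) < 2 / δ + 1 := Nat.ceil_lt_add_one (by positivity)
    have h2 : 1 ≤ 1 / δ := by rw [le_div_iff₀ hδ]; linarith
    have h3 : 3 / δ = 2 / δ + 1 / δ := by ring
    linarith
  have hcard := coverNum_le (A := A) (δ := δ)
    ((Finset.range n).image fun i : ℕ => (((i / n : ℝ)) : AddCircle (1 : ℝ))) (by
      intro y _
      obtain ⟨r, ⟨hr0, hr1⟩, rfl⟩ : ∃ r : ℝ, r ∈ Ico (0 : ℝ) 1 ∧ (r : AddCircle (1 : ℝ)) = y := by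
        have := (AddCircle.coe_image_Ico_eq (p := (1 : ℝ)) (a := 0)).ge (mem_univ y)
        simpa using this
      simp only [mem_iUnion, Finset.mem_image, Finset.mem_range, exists_prop]
      have hf : ((⌊r * n⌋₊ : ℕ) : ℝ) ≤ r * n := Nat.floor_le (by positivity)
      have hf' : r * n < (⌊r * n⌋₊ : ℕ) + 1 := Nat.lt_floor_add_one _
      refine ⟨_, ⟨⌊r * n⌋₊, ?_, rfl⟩, ?_⟩
      · have : ((⌊r * n⌋₊ : ℕ) : ℝ) < n := by nlinarith
        exact_mod_cast this
      · rw [mem_closedBall, dist_eq_norm, ← AddCircle.coe_sub]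
        refine (QuotientAddGroup.norm_mk_le_norm).trans ?_
        have h1 : r - (⌊r * n⌋₊ : ℕ) / n = (r * n - (⌊r * n⌋₊ : ℕ)) / n := by field_simp
        rw [h1, Real.norm_eq_abs, abs_of_nonneg (by apply div_nonneg <;> linarith),
          div_le_iff₀ hnpos]
        rw [div_le_iff₀ hδ] at hn0
        nlinarith)
  have : (coverNum A δ : ℝ) ≤ n := by
    exact_mod_cast hcard.trans (Finset.card_image_le.trans (Finset.card_range n).le)
  linarith

/-- If `N_δ(A) ^ 2 ≥ c / δ` for all `δ > 0`, then the lower box dimension of `A` is at least `1/2`. -/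
theorem half_le_lowerBoxDim_of_le_sq (A : Set (AddCircle (1 : ℝ))) {c : ℝ} (hc : 0 < c)
    (h : ∀ δ : ℝ, 0 < δ → c / δ ≤ (coverNum A δ : ℝ) ^ 2) : 1 / 2 ≤ lowerBoxDim A := by
  have hlog : Tendsto (fun δ : ℝ => Real.log (1 / δ)) (nhdsWithin 0 (Ioi 0)) atTop := by
    simp only [one_div]
    exact Real.tendsto_log_atTop.comp tendsto_inv_nhdsGT_zero
  have hpos : ∀ᶠ δ : ℝ in nhdsWithin 0 (Ioi 0), 0 < δ := eventually_mem_nhdsWithin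
  have hle1 : ∀ᶠ δ : ℝ in nhdsWithin 0 (Ioi 0), δ ≤ 1 :=
    mem_nhdsWithin_of_mem_nhds (Iic_mem_nhds one_pos)
  have hNpos : ∀ δ : ℝ, 0 < δ → (0 : ℝ) < coverNum A δ := by
    intro δ hδ
    have h1 : 0 < c / δ := by positivity
    have h2 := h δ hδ
    have h3 : (coverNum A δ : ℝ) ≠ 0 := by intro h0; rw [h0] at h2; norm_num at h2; linarith
    positivity
  have hlow : ∀ᶠ δ : ℝ in nhdsWithin 0 (Ioi 0),
      1 / 2 + Real.log c / 2 * (Real.log (1 / δ))⁻¹ ≤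
        Real.log (coverNum A δ) / Real.log (1 / δ) := by
    filter_upwards [hpos, hlog.eventually_gt_atTop 0] with δ hδ hl
    have h2 := Real.log_le_log (by positivity) (h δ hδ)
    rw [Real.log_pow, div_eq_mul_one_div, Real.log_mul hc.ne' (by positivity)] at h2
    push_cast at h2
    rw [le_div_iff₀ hl, add_mul, mul_assoc, inv_mul_cancel₀ hl.ne']
    linarith
  have hup : ∀ᶠ δ : ℝ in nhdsWithin 0 (Ioi 0),
      Real.log (coverNum A δ) / Real.log (1 / δ) ≤ 2 := by
    filter_upwards [hpos, hle1, hlog.eventually_ge_atTop (Real.log 3),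
      hlog.eventually_gt_atTop 0] with δ hδ hδ1 hl3 hl
    have h2 := Real.log_le_log (hNpos δ hδ) (coverNum_addCircle_le A hδ hδ1)
    rw [div_eq_mul_one_div, Real.log_mul (by norm_num) (by positivity)] at h2
    rw [div_le_iff₀ hl]
    linarith
  have hlim : Tendsto (fun δ : ℝ => 1 / 2 + Real.log c / 2 * (Real.log (1 / δ))⁻¹)
      (nhdsWithin 0 (Ioi 0)) (nhds (1 / 2)) := by
    have := (hlog.inv_tendsto_atTop.const_mul (Real.log c / 2)).const_add (1 / 2)
    rwa [mul_zero, add_zero] at this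
  rw [← hlim.liminf_eq]
  exact liminf_le_liminf hlow hlim.isBoundedUnder_ge
    (IsBoundedUnder.isCoboundedUnder_ge ⟨2, eventually_map.2 hup⟩)

theorem measure_le_card_mul {ι : Type*} (s : Finset ι) (z : ι → AddCircle (1 : ℝ)) {r : ℝ}
    (hr : 0 ≤ r) {U : Set (AddCircle (1 : ℝ))} (hU : U ⊆ ⋃ i ∈ s, closedBall (z i) r) :
    MeasureTheory.volume.real U ≤ s.card * (2 * r) := by
  calc MeasureTheory.volume.real U
      ≤ MeasureTheory.volume.real (⋃ i ∈ s, closedBall (z i) r) :=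
        MeasureTheory.measureReal_mono hU (MeasureTheory.measure_ne_top _ _)
    _ ≤ ∑ i ∈ s, MeasureTheory.volume.real (closedBall (z i) r) :=
        MeasureTheory.measureReal_biUnion_finset_le _ _
    _ ≤ ∑ _i ∈ s, 2 * r := by
        refine Finset.sum_le_sum fun i _ => ?_
        rw [MeasureTheory.measureReal_def, AddCircle.volume_closedBall,
          ENNReal.toReal_ofReal (le_min zero_le_one (by positivity))]
        exact min_le_right _ _
    _ = s.card * (2 * r) := by simp

theorem half_le_lowerBoxDim_of_sub_eq_univ {K : Set (AddCircle (1 : ℝ))} (hK : K - K = univ) :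
    1 / 2 ≤ lowerBoxDim K := by
  refine half_le_lowerBoxDim_of_le_sq K (c := 1 / 2) (by norm_num) fun δ hδ => ?_
  obtain ⟨S, hS, hcov⟩ := exists_card_eq_coverNum K hδ
  have := measure_le_card_mul (S ×ˢ S) (fun p => p.1 - p.2) hδ.le (U := univ) (by
    rw [← hK]
    rintro _ ⟨a, ha, b, hb, rfl⟩
    have ha' := hcov ha
    have hb' := hcov hb
    simp only [mem_iUnion, exists_prop] at ha' hb' ⊢
    obtain ⟨u, hu, hau⟩ := ha'
    obtain ⟨v, hv, hbv⟩ := hb'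
    refine ⟨(u, v), Finset.mk_mem_product hu hv, ?_⟩
    rw [mem_closedBall] at *
    exact (dist_sub_sub_le_of_le hau hbv).trans (by linarith))
  rw [Finset.card_product, hS, MeasureTheory.measureReal_def, AddCircle.measure_univ] at this
  push_cast at this
  rw [div_le_iff₀ hδ]
  norm_num at this
  linarith

theorem half_le_lowerBoxDim_of_interior_nonempty {K : Set (AddCircle (1 : ℝ))}
    (hK : (interior K).Nonempty) : 1 / 2 ≤ lowerBoxDim K := by
  have hvol : 0 < MeasureTheory.volume.real (interior K) :=
    ENNReal.toReal_pos (isOpen_interior.measure_pos _ hK).ne' (MeasureTheory.measure_ne_top _ _)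
  refine half_le_lowerBoxDim_of_le_sq K hvol fun δ hδ => ?_
  obtain ⟨S, hS, hcov⟩ := exists_card_eq_coverNum K hδ
  have h := measure_le_card_mul S id (by positivity) (interior_subset.trans hcov)
  rw [hS] at h
  have hsq : (coverNum K δ : ℝ) ≤ (coverNum K δ : ℝ) ^ 2 := by
    exact_mod_cast Nat.le_self_pow two_ne_zero _
  rw [div_le_iff₀ hδ]
  nlinarith

/-- If finitely many translates of a closed set `K` cover a set whose closure has non-empty
interior, then `K` has non-empty interior. -/
theorem interior_nonempty_of_translates {G : Type*} [AddCommGroup G] [TopologicalSpace G]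
    [IsTopologicalAddGroup G] {K U F : Set G} (hK : IsClosed K) (hF : F.Finite)
    (hU : (interior (closure U)).Nonempty) (h : ∀ u ∈ U, ∃ f ∈ F, u + f ∈ K) :
    (interior K).Nonempty := by
  by_contra hne
  rw [not_nonempty_iff_eq_empty] at hne
  have hcl : ∀ f : G, IsClosed ((· + f) ⁻¹' K) := fun f => hK.preimage (continuous_add_const f)
  have hempty : ∀ f : G, interior ((· + f) ⁻¹' K) = ∅ := fun f => by
    have := (Homeomorph.addRight f).preimage_interior K
    rw [hne] at this
    simpa using this.symm
  have key : interior (⋃ f ∈ F, (· + f) ⁻¹' K) = ∅ := by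
    clear h
    induction F, hF using Set.Finite.induction_on with
    | empty => simp
    | @insert a s _ hs ih =>
      rw [biUnion_insert, interior_union_isClosed_of_interior_empty (hcl a) ih, hempty]
  have hsub : closure U ⊆ ⋃ f ∈ F, (· + f) ⁻¹' K :=
    closure_minimal (fun u hu => by simpa using h u hu) (hF.isClosed_biUnion fun f _ => hcl f)
  rw [← not_nonempty_iff_eq_empty] at key
  exact key (hU.mono (interior_mono hsub))

theorem denseRange_nsmul_of_addOrderOf_eq_zero {a : AddCircle (1 : ℝ)} (ha : addOrderOf a = 0) :
    DenseRange (fun n : ℕ => n • a) :=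
  denseRange_zsmul_iff_nsmul.1 (AddCircle.denseRange_zsmul_iff.2 ha)

theorem exists_nat_forall_exists_dist_nsmul_lt {γ : AddCircle (1 : ℝ)} (hγ : addOrderOf γ = 0)
    {ε : ℝ} (hε : 0 < ε) : ∃ L : ℕ, ∀ y, ∃ i ≤ L, dist y (i • γ) < ε := by
  obtain ⟨t, ht⟩ := isCompact_univ.elim_finite_subcover (fun i : ℕ => ball (i • γ) ε)
    (fun _ => isOpen_ball) (fun y _ => by
      obtain ⟨i, hi⟩ := (denseRange_nsmul_of_addOrderOf_eq_zero hγ).exists_dist_lt y hε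
      exact mem_iUnion.2 ⟨i, hi⟩)
  refine ⟨t.sup id, fun y => ?_⟩
  have := ht (mem_univ y)
  simp only [mem_iUnion, exists_prop] at this
  obtain ⟨i, hi, hy⟩ := this
  exact ⟨i, Finset.le_sup (f := id) hi, hy⟩

theorem exists_eq_of_le_of_le_of_abs_sub_le_one {f : ℕ → ℤ} (hf : ∀ n, |f (n + 1) - f n| ≤ 1)
    {a b : ℕ} {v : ℤ} (ha : f a ≤ v) (hb : v ≤ f b) : ∃ n, f n = v := by
  have step : ∀ g : ℕ → ℤ, (∀ n, |g (n + 1) - g n| ≤ 1) → ∀ c d w, g c ≤ w → w ≤ g (c + d) →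
      ∃ n, g n = w := by
    intro g hg c d w hc hd
    induction d with
    | zero => exact ⟨c, le_antisymm hc hd⟩
    | succ d ih =>
      rcases le_or_gt w (g (c + d)) with h | h
      · exact ih h
      · refine ⟨c + (d + 1), le_antisymm ?_ hd⟩
        have := abs_le.1 (hg (c + d))
        rw [← add_assoc]
        lia
  rcases le_total a b with hab | hab
  · obtain ⟨d, rfl⟩ := Nat.exists_eq_add_of_le hab
    exact step f hf a d v ha hb
  · obtain ⟨d, rfl⟩ := Nat.exists_eq_add_of_le hab
    obtain ⟨n, hn⟩ := step (fun n => -f n) (fun n => by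
      rw [abs_sub_comm]; simpa [sub_eq_add_neg, add_comm] using hf n) b d (-v)
      (neg_le_neg hb) (neg_le_neg ha)
    exact ⟨n, neg_injective hn⟩

/-- If the number of steps of one kind in blocks of equal length has unbounded discrepancy,
the difference set of the orbit closure is the whole circle. -/
theorem sub_eq_univ_of_unbalanced {α γ x₀ : AddCircle (1 : ℝ)} (hγ : addOrderOf γ = 0)
    {k : ℕ → ℤ} (hk : ∀ n, k (n + 1) = k n ∨ k (n + 1) = k n + 1)
    {K : Set (AddCircle (1 : ℝ))} (hKc : IsClosed K)
    (hK : ∀ n : ℕ, x₀ + n • α + k n • γ ∈ K)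
    (hunb : ∀ L : ℕ, ∃ N m n : ℕ, k (m + N) - k m + L ≤ k (n + N) - k n) :
    K - K = univ := by
  have hcl : IsClosed (K - K) := by
    rw [← Set.sub_image_prod]
    exact ((hKc.isCompact.prod hKc.isCompact).image continuous_sub).isClosed
  refine eq_univ_of_forall fun y => hcl.closure_subset_iff.2 subset_rfl ?_
  refine Metric.mem_closure_iff.2 fun ε hε => ?_
  obtain ⟨L, hL⟩ := exists_nat_forall_exists_dist_nsmul_lt hγ hε
  obtain ⟨N, m, n, hmn⟩ := hunb L
  obtain ⟨i, hiL, hi⟩ := hL (y - N • α - (k (m + N) - k m) • γ)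
  obtain ⟨l, hl⟩ := exists_eq_of_le_of_le_of_abs_sub_le_one
    (f := fun n => k (n + N) - k n) (a := m) (b := n) (v := k (m + N) - k m + i)
    (fun n => by
      have h1 := hk n
      have h2 := hk (n + N)
      rw [show n + 1 + N = n + N + 1 by ring, abs_le]
      lia) (by simp) (by lia)
  refine ⟨_, sub_mem_sub (hK (l + N)) (hK l), ?_⟩
  have heq : x₀ + (l + N) • α + k (l + N) • γ - (x₀ + l • α + k l • γ) =
      i • γ + N • α + (k (m + N) - k m) • γ := by
    have : k (l + N) = k l + (k (m + N) - k m + i) := by rw [← hl]; ring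
    rw [this]
    simp only [add_smul, sub_smul, natCast_zsmul]
    abel
  rw [heq, dist_eq_norm]
  rw [dist_eq_norm] at hi
  convert hi using 2
  abel

theorem exists_slope_of_abs_sub_sub_le {k : ℕ → ℤ} {B : ℕ}
    (hB : ∀ m n, |k (m + n) - k m - k n| ≤ B) : ∃ θ : ℝ, ∀ n : ℕ, |(k n : ℝ) - n * θ| ≤ B := by
  have hk0 : |k 0| ≤ B := by simpa using hB 0 0
  have hmul : ∀ n m : ℕ, |k ((m + 1) * n) - (m + 1) * k n| ≤ m * B := by
    intro n m
    induction m with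
    | zero => simp
    | succ m ih =>
      have h1 := abs_le.1 (hB ((m + 1) * n) n)
      have h2 := abs_le.1 ih
      rw [add_mul (m + 1), one_mul, abs_le]
      push_cast
      constructor <;> nlinarith
  have hcross : ∀ m n : ℕ, ((k (n + 1) : ℝ) - B) / (n + 1) ≤ (k (m + 1) + B) / (m + 1) := by
    intro m n
    rw [div_le_div_iff₀ (by positivity) (by positivity)]
    have h1 := abs_le.1 (hmul (n + 1) m)
    have h2 := abs_le.1 (hmul (m + 1) n)
    rw [mul_comm (n + 1)] at h2
    have hB0 : (0 : ℤ) ≤ B := Int.natCast_nonneg B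
    have : (k (n + 1) - B) * ((m : ℤ) + 1) ≤ (k (m + 1) + B) * (n + 1) := by nlinarith
    exact_mod_cast this
  have hbdd : BddAbove (range fun n : ℕ => ((k (n + 1) : ℝ) - B) / (n + 1)) :=
    ⟨_, forall_mem_range.2 (hcross 0)⟩
  refine ⟨⨆ n : ℕ, ((k (n + 1) : ℝ) - B) / (n + 1), fun n => ?_⟩
  cases n with
  | zero => simpa using (by exact_mod_cast hk0 : |(k 0 : ℝ)| ≤ B)
  | succ n =>
    have h1 := le_ciSup hbdd n
    have h2 := ciSup_le (hcross n)
    have hn : (0 : ℝ) < n + 1 := by positivity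
    rw [div_le_iff₀ hn] at h1
    rw [le_div_iff₀ hn] at h2
    push_cast
    rw [abs_le]
    constructor <;> linarith

theorem AddCircle.exists_coe_eq_abs_eq_norm (t : AddCircle (1 : ℝ)) :
    ∃ r : ℝ, (r : AddCircle (1 : ℝ)) = t ∧ |r| = ‖t‖ := by
  have := (AddCircle.coe_image_Ico_eq (p := (1 : ℝ)) (a := -(1 / 2))).ge (mem_univ t)
  obtain ⟨r, ⟨h1, h2⟩, rfl⟩ := this
  refine ⟨r, rfl, ((AddCircle.norm_coe_eq_abs_iff 1 one_ne_zero).2 ?_).symm⟩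
  rw [abs_one, abs_le]
  constructor <;> linarith

/-- Simultaneous recurrence: non-negative `n` and integers `j` for which both the class of
`n α + j γ` and the height `j - n θ` tend to zero without vanishing simultaneously. -/
theorem exists_seq_tendsto_zero (α γ : AddCircle (1 : ℝ)) (θ : ℝ)
    (hne : ∀ (n : ℕ) (j : ℤ), 0 < n → n • α + j • γ = 0 → (j : ℝ) - n * θ ≠ 0) :
    ∃ (n : ℕ → ℕ) (j : ℕ → ℤ) (r : ℕ → ℝ),
      (∀ i, (r i : AddCircle (1 : ℝ)) = n i • α + j i • γ) ∧
      Tendsto r atTop (nhds 0) ∧ Tendsto (fun i => (j i : ℝ) - n i * θ) atTop (nhds 0) ∧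
      ∀ i, r i = 0 → (j i : ℝ) - n i * θ ≠ 0 := by
  let y : ℕ → AddCircle (1 : ℝ) × ℝ := fun n => (n • α + ⌊n * θ⌋ • γ, ⌊n * θ⌋ - n * θ)
  have hy : ∀ n, y n ∈ (univ : Set (AddCircle (1 : ℝ))) ×ˢ Icc (-1 : ℝ) 0 := fun n =>
    ⟨mem_univ _, by have := Int.lt_floor_add_one (n * θ); simp only [y]; linarith,
      by have := Int.floor_le (n * θ); simp only [y]; linarith⟩
  obtain ⟨a, -, φ, hφ, hlim⟩ := (isCompact_univ.prod isCompact_Icc).tendsto_subseq hy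
  have hdiff : Tendsto (fun i => y (φ (i + 1)) - y (φ i)) atTop (nhds 0) := by
    simpa using (hlim.comp (tendsto_add_atTop_nat 1)).sub hlim
  have hlt : ∀ i, φ i < φ (i + 1) := fun i => hφ (Nat.lt_succ_self i)
  choose r hr hrn using fun i => AddCircle.exists_coe_eq_abs_eq_norm (y (φ (i + 1)) - y (φ i)).1
  have hfst : ∀ i, (y (φ (i + 1)) - y (φ i)).1 =
      (φ (i + 1) - φ i) • α + (⌊φ (i + 1) * θ⌋ - ⌊φ i * θ⌋) • γ := fun i => by
    obtain ⟨d, hd⟩ := Nat.exists_eq_add_of_le (hlt i).le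
    have h2 : φ (i + 1) • α = φ i • α + d • α := by rw [hd, add_smul]
    have h3 : φ (i + 1) - φ i = d := by lia
    simp only [y, Prod.fst_sub, h2, h3, sub_smul]
    abel
  have hsnd : ∀ i, (y (φ (i + 1)) - y (φ i)).2 =
      ((⌊φ (i + 1) * θ⌋ - ⌊φ i * θ⌋ : ℤ) : ℝ) - (φ (i + 1) - φ i : ℕ) * θ := fun i => by
    rw [Nat.cast_sub (hlt i).le]
    simp only [y, Prod.snd_sub]
    push_cast
    ring
  refine ⟨fun i => φ (i + 1) - φ i, fun i => ⌊φ (i + 1) * θ⌋ - ⌊φ i * θ⌋, r, fun i => ?_, ?_, ?_,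
    fun i hi => ?_⟩
  · rw [hr, hfst]
  · rw [tendsto_zero_iff_abs_tendsto_zero]
    have := ((continuous_fst.tendsto _).comp hdiff).norm
    simp only [Prod.fst_zero, norm_zero] at this
    exact this.congr fun i => (hrn i).symm
  · exact ((continuous_snd.tendsto _).comp hdiff).congr hsnd
  · refine hne _ _ (Nat.sub_pos_of_lt (hlt i)) ?_
    rw [← hfst, ← hr, hi, AddCircle.coe_zero]

/-- The strip `{n α + j γ : n ≥ 0, |j - n θ| ≤ 1}` is dense in some arc. -/
theorem interior_closure_strip_nonempty {α γ : AddCircle (1 : ℝ)} (hγ : addOrderOf γ = 0) (θ : ℝ)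
    (hne : ∀ (n : ℕ) (j : ℤ), 0 < n → n • α + j • γ = 0 → (j : ℝ) - n * θ ≠ 0) :
    (interior (closure {z | ∃ (n : ℕ) (j : ℤ), |(j : ℝ) - n * θ| ≤ 1 ∧
      z = n • α + j • γ})).Nonempty := by
  obtain ⟨n, j, r, hr, hr0, hd0, hrd⟩ := exists_seq_tendsto_zero α γ θ hne
  set d : ℕ → ℝ := fun i => (j i : ℝ) - n i * θ with hd
  set S := {z | ∃ (n : ℕ) (j : ℤ), |(j : ℝ) - n * θ| ≤ 1 ∧ z = n • α + j • γ}
  by_cases hc : ∃ c > 0, ∃ᶠ i in atTop, c * |d i| ≤ |r i|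
  · obtain ⟨c, hc0, hfreq⟩ := hc
    obtain ⟨s, hs, hfreq⟩ : ∃ s : ℝ, |s| = 1 ∧
        ∃ᶠ i in atTop, c * |d i| ≤ |r i| ∧ r i = s * |r i| := by
      have : ∃ᶠ i in atTop, (c * |d i| ≤ |r i| ∧ r i = 1 * |r i|) ∨
          (c * |d i| ≤ |r i| ∧ r i = (-1) * |r i|) := by
        refine hfreq.mono fun i hi => ?_
        rcases abs_cases (r i) with h | h
        · exact Or.inl ⟨hi, by linarith⟩
        · exact Or.inr ⟨hi, by linarith⟩
      rcases frequently_or_distrib.1 this with h | h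
      · exact ⟨1, by simp, h⟩
      · exact ⟨-1, by simp, h⟩
    have hmem : ∀ y ∈ Ioo 0 c, ((s * y : ℝ) : AddCircle (1 : ℝ)) ∈ closure S := by
      rintro y ⟨hy0, hyc⟩
      refine Metric.mem_closure_iff.2 fun ε hε => ?_
      have hsmall : ∀ᶠ i in atTop, |r i| < ε := by
        have := hr0.abs
        rw [abs_zero] at this
        exact this.eventually_lt_const hε
      obtain ⟨i, ⟨hci, hsi⟩, hi⟩ := (hfreq.and_eventually hsmall).exists
      have hrpos : 0 < |r i| := by
        refine abs_pos.2 fun h0 => hrd i h0 ?_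
        rw [h0, abs_zero] at hci
        have := abs_nonneg (d i)
        exact abs_eq_zero.1 (by nlinarith)
      set m := ⌊y / |r i|⌋₊
      have hm1 : m * |r i| ≤ y := (le_div_iff₀ hrpos).1 (Nat.floor_le (by positivity))
      have hm2 : y < (m + 1) * |r i| := (div_lt_iff₀ hrpos).1 (Nat.lt_floor_add_one _)
      refine ⟨m • (r i : AddCircle (1 : ℝ)), ⟨m * n i, m * j i, ?_, ?_⟩, ?_⟩
      · have : ((m * j i : ℤ) : ℝ) - (m * n i : ℕ) * θ = m * d i := by
          simp only [hd]; push_cast; ring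
        rw [this, abs_mul, Nat.abs_cast]
        have h1 : m * (c * |d i|) ≤ m * |r i| := by gcongr
        have h2 : c * (m * |d i|) ≤ c * 1 := by linarith
        exact le_of_mul_le_mul_left h2 hc0
      · rw [hr, smul_add, mul_smul, mul_smul, natCast_zsmul]
      · rw [← AddCircle.coe_nsmul, dist_eq_norm, ← AddCircle.coe_sub]
        refine (QuotientAddGroup.norm_mk_le_norm).trans_lt ?_
        rw [nsmul_eq_mul, Real.norm_eq_abs]
        have : s * y - m * r i = s * (y - m * |r i|) := by
          rw [mul_sub, mul_left_comm, ← hsi]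
        rw [this, abs_mul, hs, one_mul, abs_of_nonneg (by linarith)]
        linarith
    have hs0 : s ≠ 0 := by rintro rfl; simp at hs
    have hopen : IsOpen ((fun y : ℝ => ((s * y : ℝ) : AddCircle (1 : ℝ))) '' Ioo 0 c) := by
      have h := QuotientAddGroup.isOpenMap_coe (G := ℝ) (N := AddSubgroup.zmultiples (1 : ℝ))
      exact (h.comp (Homeomorph.mulLeft₀ s hs0).isOpenMap) _ isOpen_Ioo
    exact ((nonempty_Ioo.2 hc0).image _).mono (interior_maximal (image_subset_iff.2 hmem) hopen)
  · push Not at hc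
    obtain ⟨s, hs, hfreq⟩ : ∃ s : ℤ, (s = 1 ∨ s = -1) ∧ ∃ᶠ i in atTop, d i = -s * |d i| := by
      have : ∃ᶠ i in atTop, d i = -(1 : ℤ) * |d i| ∨ d i = -(-1 : ℤ) * |d i| := by
        refine Eventually.frequently (Eventually.of_forall fun i => ?_)
        rcases abs_cases (d i) with h | h
        · right; push_cast; linarith
        · left; push_cast; linarith
      rcases frequently_or_distrib.1 this with h | h
      · exact ⟨1, by simp, h⟩
      · exact ⟨-1, by simp, h⟩
    have hsγ : addOrderOf (s • γ) = 0 := by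
      rcases hs with rfl | rfl <;> simpa using hγ
    have hmem : ∀ J : ℕ, J • (s • γ) ∈ closure S := by
      intro J
      refine Metric.mem_closure_iff.2 fun ε hε => ?_
      have hsmall : ∀ᶠ i in atTop, |d i| < 1 := by
        have := hd0.abs
        rw [abs_zero] at this
        exact this.eventually_lt_const one_pos
      obtain ⟨i, hsi, hi, hci⟩ :=
        (hfreq.and_eventually (hsmall.and (hc (ε / (J + 1)) (by positivity)))).exists
      have hdpos : 0 < |d i| := by
        by_contra h
        have h0 : |d i| = 0 := le_antisymm (not_lt.1 h) (abs_nonneg _)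
        rw [h0, mul_zero] at hci
        exact absurd hci (not_lt.2 (abs_nonneg _))
      set m := ⌊J / |d i|⌋₊
      have hm1 : m * |d i| ≤ J := (le_div_iff₀ hdpos).1 (Nat.floor_le (by positivity))
      have hm2 : J < (m + 1) * |d i| := (div_lt_iff₀ hdpos).1 (Nat.lt_floor_add_one _)
      refine ⟨m • (r i : AddCircle (1 : ℝ)) + J • (s • γ),
        ⟨m * n i, m * j i + J * s, ?_, ?_⟩, ?_⟩
      · have : ((m * j i + J * s : ℤ) : ℝ) - (m * n i : ℕ) * θ = s * (J - m * |d i|) := by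
          have h : (m : ℝ) * d i = m * (-s * |d i|) := by rw [← hsi]
          simp only [hd] at h ⊢
          push_cast
          linarith
        have hs1 : |(s : ℝ)| = 1 := by rcases hs with rfl | rfl <;> simp
        rw [this, abs_mul, hs1, one_mul, abs_of_nonneg (by linarith)]
        linarith
      · rw [hr, smul_add, add_smul, mul_smul, mul_smul, mul_smul, natCast_zsmul, natCast_zsmul,
          add_assoc]
      · rw [dist_eq_norm, ← AddCircle.coe_nsmul, sub_add_cancel_right, norm_neg]
        refine (QuotientAddGroup.norm_mk_le_norm).trans_lt ?_
        rw [nsmul_eq_mul, Real.norm_eq_abs, abs_mul, Nat.abs_cast]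
        calc m * |r i| ≤ m * (ε / (J + 1) * |d i|) := by gcongr
          _ = ε / (J + 1) * (m * |d i|) := by ring
          _ ≤ ε / (J + 1) * J := by gcongr
          _ < ε := by rw [div_mul_eq_mul_div, div_lt_iff₀ (by positivity)]; linarith
    have huniv : closure S = univ := by
      have h := (denseRange_nsmul_of_addOrderOf_eq_zero hsγ).closure_eq
      exact univ_subset_iff.1 (h ▸ closure_minimal (range_subset_iff.2 hmem) isClosed_closure)
    rw [huniv, interior_univ]
    exact univ_nonempty

theorem exists_counting_seq {a b : AddCircle (1 : ℝ)} {x : ℕ → AddCircle (1 : ℝ)}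
    (h : ∀ n, x (n + 1) - x n ∈ ({a, b} : Set (AddCircle (1 : ℝ)))) :
    ∃ k : ℕ → ℤ, k 0 = 0 ∧ (∀ n, k (n + 1) = k n ∨ k (n + 1) = k n + 1) ∧
      ∀ n, x n = x 0 + n • b + k n • (a - b) := by
  classical
  refine ⟨fun n => ∑ i ∈ Finset.range n, if x (i + 1) - x i = b then 0 else 1, by simp,
    fun n => ?_, fun n => ?_⟩
  · simp only [Finset.sum_range_succ]
    split_ifs <;> simp
  · induction n with
    | zero => simp
    | succ n ih =>
      dsimp only at ih ⊢
      rw [Finset.sum_range_succ, add_smul, add_smul]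
      split_ifs with hb
      · rw [eq_add_of_sub_eq hb, ih, one_smul, zero_smul]
        abel
      · rw [eq_add_of_sub_eq ((h n).resolve_right hb), ih, one_smul, one_smul]
        abel

theorem interior_nonempty_of_torsion {α γ x₀ : AddCircle (1 : ℝ)} (hγ : addOrderOf γ ≠ 0)
    {k : ℕ → ℤ} {x : ℕ → AddCircle (1 : ℝ)} (hx : ∀ n, x n = x₀ + n • α + k n • γ)
    (hinf : (range x).Infinite) : (interior (closure (range x))).Nonempty := by
  have hfin : ∀ a : AddCircle (1 : ℝ), addOrderOf a ≠ 0 →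
      (AddSubgroup.zmultiples a : Set (AddCircle (1 : ℝ))).Finite := fun a ha =>
    finite_zmultiples.2 (addOrderOf_pos_iff.1 (Nat.pos_of_ne_zero ha))
  have hα : addOrderOf α = 0 := by
    by_contra hα
    refine hinf ((((finite_singleton x₀).add (hfin α hα)).add (hfin γ hγ)).subset ?_)
    rintro _ ⟨n, rfl⟩
    rw [hx]
    exact add_mem_add (add_mem_add rfl (AddSubgroup.nsmul_mem_zmultiples α n))
      (AddSubgroup.zsmul_mem_zmultiples γ _)
  refine interior_nonempty_of_translates isClosed_closure
    ((finite_singleton x₀).add (hfin γ hγ)) (U := range fun n : ℕ => n • α) ?_ ?_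
  · rw [(denseRange_nsmul_of_addOrderOf_eq_zero hα).closure_eq, interior_univ]
    exact univ_nonempty
  · rintro _ ⟨n, rfl⟩
    refine ⟨x₀ + k n • γ, add_mem_add rfl (AddSubgroup.zsmul_mem_zmultiples γ _),
      subset_closure ⟨n, ?_⟩⟩
    rw [hx]
    abel

/-- If the number of steps of one kind stays within bounded distance of a linear function,
the orbit closure has non-empty interior. -/
theorem interior_nonempty_of_balanced {α γ x₀ : AddCircle (1 : ℝ)} (hγ : addOrderOf γ = 0)
    {k : ℕ → ℤ} {x : ℕ → AddCircle (1 : ℝ)} (hx : ∀ n, x n = x₀ + n • α + k n • γ)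
    {θ : ℝ} {B : ℕ} (hθ : ∀ n : ℕ, |(k n : ℝ) - n * θ| ≤ B)
    (hinf : (range x).Infinite) : (interior (closure (range x))).Nonempty := by
  have hne : ∀ (n : ℕ) (j : ℤ), 0 < n → n • α + j • γ = 0 → (j : ℝ) - n * θ ≠ 0 := by
    intro N J hN hzero hJ
    obtain ⟨M, hM⟩ := exists_nat_gt (N * |θ|)
    refine hinf ((((finite_Iio N).prod (finite_Icc (-(B + M : ℤ)) (B + M))).image
      fun p : ℕ × ℤ => x₀ + p.1 • α + p.2 • γ).subset ?_)
    rintro _ ⟨n, rfl⟩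
    have hdiv : (N : ℝ) * (n / N : ℕ) + (n % N : ℕ) = n := by exact_mod_cast Nat.div_add_mod n N
    have hmod : n % N < N := Nat.mod_lt n hN
    refine ⟨(n % N, k n - (n / N : ℕ) * J), ⟨hmod, ?_⟩, ?_⟩
    · have h1 : ((k n - (n / N : ℕ) * J : ℤ) : ℝ) = (k n - n * θ) + (n % N : ℕ) * θ := by
        rw [← hdiv]
        simp only [Int.cast_sub, Int.cast_mul, Int.cast_natCast]
        linear_combination -((n / N : ℕ) : ℝ) * hJ
      have h2 : |((k n - (n / N : ℕ) * J : ℤ) : ℝ)| ≤ B + M := by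
        rw [h1]
        refine (abs_add_le _ _).trans (add_le_add (hθ n) ?_)
        rw [abs_mul, Nat.abs_cast]
        refine le_trans ?_ hM.le
        gcongr
      have h3 : |k n - (n / N : ℕ) * J| ≤ (B + M : ℤ) := by exact_mod_cast h2
      exact abs_le.1 h3
    · have h1 : n • α = (n / N) • (N • α) + (n % N) • α := by
        rw [← mul_smul, ← add_smul, Nat.div_add_mod']
      dsimp only
      rw [hx, h1, eq_neg_of_add_eq_zero_left hzero, sub_smul, mul_smul, natCast_zsmul, smul_neg]
      abel
  refine interior_nonempty_of_translates isClosed_closure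
    ((finite_Icc (-(B + 1 : ℤ)) (B + 1)).image fun i : ℤ => x₀ + i • γ)
    (interior_closure_strip_nonempty hγ θ hne) ?_
  rintro _ ⟨n, j, hj, rfl⟩
  refine ⟨_, ⟨k n - j, ?_, rfl⟩, subset_closure ⟨n, ?_⟩⟩
  · have h1 : |((k n - j : ℤ) : ℝ)| ≤ B + 1 := by
      have : ((k n - j : ℤ) : ℝ) = (k n - n * θ) - (j - n * θ) := by push_cast; ring
      rw [this]
      exact (abs_sub _ _).trans (add_le_add (hθ n) hj)
    have h2 : |k n - j| ≤ (B + 1 : ℤ) := by exact_mod_cast h1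
    exact abs_le.1 h2
  · simp only [hx, sub_smul]
    abel

theorem sub_eq_univ_or_interior_nonempty {a b : AddCircle (1 : ℝ)} {x : ℕ → AddCircle (1 : ℝ)}
    (h : ∀ n, x (n + 1) - x n ∈ ({a, b} : Set (AddCircle (1 : ℝ)))) (hinf : (range x).Infinite) :
    closure (range x) - closure (range x) = univ ∨ (interior (closure (range x))).Nonempty := by
  obtain ⟨k, hk0, hk, hx⟩ := exists_counting_seq h
  by_cases hγ : addOrderOf (a - b) = 0
  · by_cases hunb : ∀ L : ℕ, ∃ N m n : ℕ, k (m + N) - k m + L ≤ k (n + N) - k n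
    · exact Or.inl (sub_eq_univ_of_unbalanced hγ hk isClosed_closure
        (fun n => subset_closure ⟨n, hx n⟩) hunb)
    · push Not at hunb
      obtain ⟨B, hB⟩ := hunb
      obtain ⟨θ, hθ⟩ := exists_slope_of_abs_sub_sub_le (k := k) (B := B) fun m n => by
        have h1 := hB n m 0
        have h2 := hB n 0 m
        simp only [zero_add, hk0] at h1 h2
        rw [abs_le]
        lia
      exact Or.inr (interior_nonempty_of_balanced hγ hx hθ hinf)
  · exact Or.inr (interior_nonempty_of_torsion hγ hx hinf)

theorem stmt8 (α₁ α₂ : ℝ) (x : ℕ → AddCircle (1 : ℝ))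
    (horbit : ∀ n : ℕ, x (n + 1) - x n ∈
      ({((α₁ : ℝ) : AddCircle (1 : ℝ)), ((α₂ : ℝ) : AddCircle (1 : ℝ))} :
        Set (AddCircle (1 : ℝ))))
    (hinf : (Set.range x).Infinite) :
    (closure (Set.range x) - closure (Set.range x) = Set.univ ∨
      (interior (closure (Set.range x))).Nonempty) ∧
    1 / 2 ≤ lowerBoxDim (closure (Set.range x)) := by
  have h := sub_eq_univ_or_interior_nonempty horbit hinf
  exact ⟨h, h.elim half_le_lowerBoxDim_of_sub_eq_univ half_le_lowerBoxDim_of_interior_nonempty⟩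
end

section
/- Let E, F ⊂ R^d be nontrivial self-similar sets generated by IFSs Φ = {φ_i}_{i=1}^ℓ and Ψ = {ψ_j}_{j=1}^m of contracting similitudes with contraction ratios ρ_i and γ_j respectively, where Φ satisfies the strong separation condition and all ρ_i are equal to some ρ (homogeneous case with ℓ = 2, so dim_Q span_Q(log ρ_1, log ρ_2) = 1). Suppose dim_H E < 1/4 and F can be affinely embedded into E (i.e., M(F) + b ⊂ E for some invertible d×d matrix M and b ∈ R^d). Then log γ_j / log ρ ∈ Q for every 1 ≤ j ≤ m. -/
open Set Filter Topology MeasureTheory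

namespace SelfSimilar

theorem map_mem {X : Type*} {φ : Fin 2 → X → X} {E : Set X} (hE : E = ⋃ i, φ i '' E) (i : Fin 2)
    {u : X} (hu : u ∈ E) : φ i u ∈ E := by
  rw [hE]
  exact mem_iUnion.2 ⟨i, mem_image_of_mem _ hu⟩

theorem exists_preimage {X : Type*} {φ : Fin 2 → X → X} {E : Set X} (hE : E = ⋃ i, φ i '' E)
    {u : X} (hu : u ∈ E) : ∃ i, ∃ v ∈ E, φ i v = u := by
  rw [hE] at hu
  simpa using hu

section Pair

variable {X : Type*} [MetricSpace X] {φ : Fin 2 → X → X} {ρ : ℝ} {E : Set X}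

/-- The set of distances between points of `E`. -/
def distSet (E : Set X) : Set ℝ := (fun p : X × X => dist p.1 p.2) '' E ×ˢ E

theorem dist_mem_distSet {u v : X} (hu : u ∈ E) (hv : v ∈ E) : dist u v ∈ distSet E :=
  ⟨(u, v), ⟨hu, hv⟩, rfl⟩

theorem isClosed_distSet (hEc : IsCompact E) : IsClosed (distSet E) :=
  ((hEc.prod hEc).image continuous_dist).isClosed

theorem continuous_of_dist_eq {f : X → X} (hf : ∀ x y, dist (f x) (f y) = ρ * dist x y) :
    Continuous f :=
  (LipschitzWith.of_dist_le' fun x y => (hf x y).le).continuous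

/-- Under strong separation, points of different first-level pieces are uniformly apart. -/
theorem exists_gap (hEc : IsCompact E)
    (hφ : ∀ i x y, dist (φ i x) (φ i y) = ρ * dist x y)
    (hssc : Pairwise fun i j => Disjoint (φ i '' E) (φ j '' E)) :
    ∃ c > 0, ∀ i j, ∀ u ∈ E, ∀ v ∈ E, dist (φ i u) (φ j v) < c → i = j := by
  have hcomp : ∀ i, IsCompact (φ i '' E) := fun i =>
    hEc.image (continuous_of_dist_eq (hφ i))
  obtain ⟨c, hc, h⟩ := (hssc (zero_ne_one : (0 : Fin 2) ≠ 1)).exists_thickenings (hcomp 0)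
    (hcomp 1).isClosed
  have key : ∀ u ∈ E, ∀ v ∈ E, c ≤ dist (φ 0 u) (φ 1 v) := by
    intro u hu v hv
    by_contra! hlt
    refine Set.disjoint_left.1 h
      (Metric.self_subset_thickening hc _ (mem_image_of_mem _ hu)) ?_
    exact Metric.mem_thickening_iff.2 ⟨_, mem_image_of_mem _ hv, hlt⟩
  refine ⟨c, hc, ?_⟩
  intro i j u hu v hv hlt
  fin_cases i <;> fin_cases j
  · rfl
  · exact absurd hlt (not_lt.2 (key u hu v hv))
  · exact absurd hlt (not_lt.2 (dist_comm (φ 1 u) (φ 0 v) ▸ key v hv u hu))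
  · rfl

theorem mul_mem_distSet (hφ : ∀ i x y, dist (φ i x) (φ i y) = ρ * dist x y)
    (hE : E = ⋃ i, φ i '' E) {r : ℝ} (hr : r ∈ distSet E) : ρ * r ∈ distSet E := by
  obtain ⟨⟨u, v⟩, ⟨hu, hv⟩, rfl⟩ := hr
  rw [← hφ 0]
  exact dist_mem_distSet (map_mem hE 0 hu) (map_mem hE 0 hv)

theorem mem_distSet_of_mul_mem (hρ : 0 < ρ)
    (hφ : ∀ i x y, dist (φ i x) (φ i y) = ρ * dist x y) (hE : E = ⋃ i, φ i '' E) {c : ℝ}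
    (hc : ∀ i j, ∀ u ∈ E, ∀ v ∈ E, dist (φ i u) (φ j v) < c → i = j) {r : ℝ}
    (hrc : ρ * r < c) (hr : ρ * r ∈ distSet E) : r ∈ distSet E := by
  obtain ⟨⟨u, v⟩, ⟨hu, hv⟩, huv⟩ := hr
  obtain ⟨i, u, hu', rfl⟩ := exists_preimage hE hu
  obtain ⟨j, v, hv', rfl⟩ := exists_preimage hE hv
  simp only at huv
  obtain rfl := hc i j u hu' v hv' (huv ▸ hrc)
  rw [hφ] at huv
  rw [← mul_left_cancel₀ hρ.ne' huv]
  exact dist_mem_distSet hu' hv'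

/-- At scales below the gap, the set of distances is invariant under multiplication by any
integer power of the ratio. -/
theorem mem_distSet_of_zpow_mul_mem (hρ0 : 0 < ρ) (hρ1 : ρ < 1)
    (hφ : ∀ i x y, dist (φ i x) (φ i y) = ρ * dist x y) (hE : E = ⋃ i, φ i '' E) {c : ℝ}
    (hc : ∀ i j, ∀ u ∈ E, ∀ v ∈ E, dist (φ i u) (φ j v) < c → i = j) {r : ℝ}
    (hr0 : 0 ≤ r) (hrc : r < c) (k : ℤ) (hr : ρ ^ k * r ∈ distSet E) : r ∈ distSet E := by
  obtain ⟨n, rfl | rfl⟩ := k.eq_nat_or_neg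
  · rw [zpow_natCast] at hr
    induction n with
    | zero => simpa using hr
    | succ n ih =>
      refine ih (mem_distSet_of_mul_mem hρ0 hφ hE hc ?_ (by rwa [← mul_assoc, ← pow_succ']))
      rw [← mul_assoc, ← pow_succ']
      exact (mul_le_of_le_one_left hr0 (pow_le_one₀ hρ0.le hρ1.le)).trans_lt hrc
  · have h : ∀ n : ℕ, ∀ s ∈ distSet E, ρ ^ n * s ∈ distSet E := by
      intro n s hs
      induction n with
      | zero => simpa using hs
      | succ n ih =>
        rw [pow_succ', mul_assoc]
        exact mul_mem_distSet hφ hE ih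
    have := h n _ hr
    rwa [zpow_neg, zpow_natCast, mul_inv_cancel_left₀ (pow_pos hρ0 n).ne'] at this

theorem exists_finset_cover (hφ : ∀ i x y, dist (φ i x) (φ i y) = ρ * dist x y)
    (hρ : 0 ≤ ρ) (hE : E = ⋃ i, φ i '' E) {x : X} {R : ℝ} (hR : E ⊆ Metric.closedBall x R)
    (n : ℕ) :
    ∃ T : Finset X, T.card ≤ 2 ^ n ∧ ∀ u ∈ E, ∃ t ∈ T, dist u t ≤ ρ ^ n * R := by
  classical
  induction n with
  | zero => exact ⟨{x}, by simp, fun u hu => ⟨x, by simp, by simpa using hR hu⟩⟩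
  | succ n ih =>
    obtain ⟨T, hT, hcov⟩ := ih
    refine ⟨T.image (φ 0) ∪ T.image (φ 1), ?_, ?_⟩
    · have h0 := Finset.card_union_le (T.image (φ 0)) (T.image (φ 1))
      have h1 := Finset.card_image_le (s := T) (f := φ 0)
      have h2 := Finset.card_image_le (s := T) (f := φ 1)
      rw [pow_succ]
      omega
    · intro u hu
      obtain ⟨i, v, hv, rfl⟩ := exists_preimage hE hu
      obtain ⟨t, ht, hvt⟩ := hcov v hv
      refine ⟨φ i t, ?_, ?_⟩
      · fin_cases i
        · exact Finset.mem_union_left _ (Finset.mem_image_of_mem _ ht)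
        · exact Finset.mem_union_right _ (Finset.mem_image_of_mem _ ht)
      · rw [hφ, pow_succ', mul_assoc]
        exact mul_le_mul_of_nonneg_left hvt hρ

/-- If the ratio is less than `1 / 4`, the set of distances is Lebesgue null. -/
theorem volume_distSet_eq_zero (hφ : ∀ i x y, dist (φ i x) (φ i y) = ρ * dist x y)
    (hρ : 0 ≤ ρ) (hρ4 : ρ < 1 / 4) (hE : E = ⋃ i, φ i '' E) (hEc : IsCompact E)
    (hEne : E.Nonempty) : volume (distSet E) = 0 := by
  obtain ⟨x, -⟩ := hEne
  obtain ⟨R, hR⟩ := hEc.isBounded.subset_closedBall x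
  have hbound : ∀ n : ℕ, volume (distSet E) ≤ ENNReal.ofReal ((4 * ρ) ^ n * (4 * R)) := by
    intro n
    obtain ⟨T, hT, hcov⟩ := exists_finset_cover hφ hρ hE hR n
    have hsub : distSet E ⊆ ⋃ p ∈ T ×ˢ T,
        Metric.closedBall (dist p.1 p.2) (2 * (ρ ^ n * R)) := by
      rintro _ ⟨⟨u, v⟩, ⟨hu, hv⟩, rfl⟩
      obtain ⟨s, hs, hus⟩ := hcov u hu
      obtain ⟨t, ht, hvt⟩ := hcov v hv
      refine mem_iUnion₂.2 ⟨(s, t), Finset.mk_mem_product hs ht, ?_⟩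
      have := dist_dist_dist_le u v s t
      simp only [Metric.mem_closedBall]
      linarith
    calc volume (distSet E)
        ≤ ∑ p ∈ T ×ˢ T, volume (Metric.closedBall (dist p.1 p.2) (2 * (ρ ^ n * R))) :=
          (measure_mono hsub).trans (measure_biUnion_finset_le _ _)
      _ = ((T.card * T.card : ℕ) : ENNReal) * ENNReal.ofReal (2 * (2 * (ρ ^ n * R))) := by
          simp [Real.volume_closedBall, Finset.card_product]
      _ ≤ ((2 ^ n * 2 ^ n : ℕ) : ENNReal) * ENNReal.ofReal (2 * (2 * (ρ ^ n * R))) := by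
          gcongr
      _ = ENNReal.ofReal ((4 * ρ) ^ n * (4 * R)) := by
          rw [← ENNReal.ofReal_natCast, ← ENNReal.ofReal_mul (by positivity)]
          congr 1
          push_cast
          rw [← mul_pow, mul_pow 4 ρ]
          norm_num
          ring
  have hlim : Tendsto (fun n : ℕ => ENNReal.ofReal ((4 * ρ) ^ n * (4 * R))) atTop (𝓝 0) := by
    have := (tendsto_pow_atTop_nhds_zero_of_lt_one (r := 4 * ρ) (by positivity)
      (by linarith)).mul_const (4 * R)
    simpa using ENNReal.tendsto_ofReal this
  exact le_antisymm (ge_of_tendsto' hlim hbound) zero_le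

/-- The binary coding of `E`, normalized to take values in the unit interval. -/
theorem exists_binary_coding (hρ : 0 < ρ)
    (hφ : ∀ i x y, dist (φ i x) (φ i y) = ρ * dist x y) (hE : E = ⋃ i, φ i '' E)
    (hssc : Pairwise fun i j => Disjoint (φ i '' E) (φ j '' E)) :
    ∃ f : X → ℝ, (∀ u, f u ∈ Icc (0 : ℝ) 1) ∧
      ∀ i, ∀ u ∈ E, f (φ i u) = ((i : ℕ) + f u) / 2 := by
  classical
  have hsel : ∀ u, ∃ p : Fin 2 × X, u ∈ E → p.2 ∈ E ∧ φ p.1 p.2 = u := by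
    intro u
    by_cases hu : u ∈ E
    · obtain ⟨i, v, hv, h⟩ := exists_preimage hE hu
      exact ⟨(i, v), fun _ => ⟨hv, h⟩⟩
    · exact ⟨(0, u), fun h => absurd h hu⟩
  choose p hp using hsel
  have hpφ : ∀ i, ∀ u ∈ E, p (φ i u) = (i, u) := by
    intro i u hu
    obtain ⟨h1, h2⟩ := hp _ (map_mem hE i hu)
    have hi : (p (φ i u)).1 = i := by
      by_contra hne
      exact Set.disjoint_left.1 (hssc hne) (mem_image_of_mem _ h1)
        (by rw [h2]; exact mem_image_of_mem _ hu)
    rw [hi] at h2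
    refine Prod.ext hi ?_
    have h3 := hφ i (p (φ i u)).2 u
    rw [h2, dist_self, zero_eq_mul] at h3
    exact dist_eq_zero.1 (h3.resolve_left hρ.ne')
  set σ : X → X := fun u => (p u).2
  set a : X → ℕ → ℝ := fun u n => (((p (σ^[n] u)).1 : ℕ) : ℝ) * (1 / 2 / 2 ^ n)
  have hgeom : HasSum (fun n : ℕ => (1 : ℝ) / 2 / 2 ^ n) 1 := hasSum_geometric_two' 1
  have ha0 : ∀ u n, 0 ≤ a u n := fun u n => by positivity
  have ha1 : ∀ u n, a u n ≤ 1 / 2 / 2 ^ n := by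
    intro u n
    refine mul_le_of_le_one_left (by positivity) ?_
    exact_mod_cast Nat.le_of_lt_succ (p (σ^[n] u)).1.isLt
  have hsum : ∀ u, Summable (a u) := fun u =>
    Summable.of_nonneg_of_le (ha0 u) (ha1 u) hgeom.summable
  refine ⟨fun u => ∑' n, a u n, fun u => ⟨tsum_nonneg (ha0 u), ?_⟩, fun i u hu => ?_⟩
  · exact ((hsum u).tsum_le_tsum (ha1 u) hgeom.summable).trans_eq hgeom.tsum_eq
  · have hstep : ∀ n, a (φ i u) (n + 1) = a u n * (1 / 2) := by
      intro n
      have : σ (φ i u) = u := by simp only [σ, hpφ i u hu]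
      simp only [a, Function.iterate_succ_apply, this]
      rw [pow_succ]
      field_simp
    simp only
    rw [(hsum _).tsum_eq_zero_add]
    simp only [hstep, tsum_mul_right]
    simp only [a, Function.iterate_zero, id, hpφ i u hu]
    ring

theorem sq_coding_sub_le (hρ : 1 / 4 ≤ ρ) (hρ1 : ρ < 1)
    (hφ : ∀ i x y, dist (φ i x) (φ i y) = ρ * dist x y) (hE : E = ⋃ i, φ i '' E) {c : ℝ}
    (hc0 : 0 < c)
    (hc : ∀ i j, ∀ u ∈ E, ∀ v ∈ E, dist (φ i u) (φ j v) < c → i = j) {f : X → ℝ}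
    (hf01 : ∀ u, f u ∈ Icc (0 : ℝ) 1)
    (hf : ∀ i, ∀ u ∈ E, f (φ i u) = ((i : ℕ) + f u) / 2) {u v : X} (hu : u ∈ E) (hv : v ∈ E) :
    (f u - f v) ^ 2 ≤ dist u v / c := by
  have hfar : ∀ u v, c ≤ dist u v → (f u - f v) ^ 2 ≤ dist u v / c := by
    intro u v huv
    have h1 : 1 ≤ dist u v / c := (one_le_div hc0).2 huv
    have := hf01 u
    have := hf01 v
    simp only [mem_Icc] at *
    nlinarith
  have key : ∀ N : ℕ, ∀ u ∈ E, ∀ v ∈ E, ρ ^ N * c ≤ dist u v →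
      (f u - f v) ^ 2 ≤ dist u v / c := by
    intro N
    induction N with
    | zero => exact fun u _ v _ h => hfar u v (by simpa using h)
    | succ N ih =>
      intro u hu v hv huv
      rcases le_or_gt c (dist u v) with h | h
      · exact hfar u v h
      obtain ⟨i, u, hu', rfl⟩ := exists_preimage hE hu
      obtain ⟨j, v, hv', rfl⟩ := exists_preimage hE hv
      obtain rfl := hc i j u hu' v hv' h
      rw [hφ, pow_succ', mul_assoc] at huv
      have h1 := ih u hu' v hv' (le_of_mul_le_mul_left huv (by linarith))
      rw [hf i u hu', hf i v hv', hφ, mul_div_assoc]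
      have h2 : 0 ≤ dist u v / c := by positivity
      nlinarith
  rcases eq_or_ne u v with rfl | hne
  · simp
  · obtain ⟨N, hN⟩ := exists_pow_lt_of_lt_one (div_pos (dist_pos.2 hne) hc0) hρ1
    exact key N u hu v hv ((lt_div_iff₀ hc0).1 hN).le

/-- A strongly separated pair of similitudes with common ratio at least `1 / 4` has an attractor
of dimension at least `1 / 2`. -/
theorem half_le_dimH (hρ : 1 / 4 ≤ ρ) (hρ1 : ρ < 1)
    (hφ : ∀ i x y, dist (φ i x) (φ i y) = ρ * dist x y) (hE : E = ⋃ i, φ i '' E)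
    (hEc : IsCompact E) (hEne : E.Nonempty)
    (hssc : Pairwise fun i j => Disjoint (φ i '' E) (φ j '' E)) : 1 / 2 ≤ dimH E := by
  have hρ0 : 0 < ρ := by linarith
  obtain ⟨c, hc0, hc⟩ := exists_gap hEc hφ hssc
  obtain ⟨f, hf01, hf⟩ := exists_binary_coding hρ0 hφ hE hssc
  have hhol : HolderOnWith (Real.toNNReal (Real.sqrt c⁻¹)) (1 / 2) f E := by
    intro u hu v hv
    have h := Real.abs_le_sqrt (sq_coding_sub_le hρ hρ1 hφ hE hc0 hc hf01 hf hu hv)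
    rw [div_eq_inv_mul, Real.sqrt_mul (by positivity)] at h
    rw [edist_dist, edist_dist, Real.dist_eq, ENNReal.ofReal_rpow_of_nonneg dist_nonneg (by simp)]
    change _ ≤ ENNReal.ofReal _ * _
    rw [← ENNReal.ofReal_mul (by positivity)]
    refine ENNReal.ofReal_le_ofReal (h.trans_eq ?_)
    rw [Real.sqrt_eq_rpow (dist u v)]
    simp
  have hdense : ∀ n : ℕ, ∀ t ∈ Icc (0 : ℝ) 1, ∃ u ∈ E, |f u - t| ≤ (1 / 2) ^ n := by
    intro n
    induction n with
    | zero =>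
      obtain ⟨u, hu⟩ := hEne
      intro t ht
      refine ⟨u, hu, ?_⟩
      have := hf01 u
      simp only [mem_Icc] at this ht
      rw [pow_zero, abs_le]
      constructor <;> linarith
    | succ n ih =>
      intro t ht
      simp only [mem_Icc] at ht
      have hstep : ∀ i : Fin 2, 2 * t - (i : ℕ) ∈ Icc (0 : ℝ) 1 →
          ∃ u ∈ E, |f u - t| ≤ (1 / 2) ^ (n + 1) := by
        intro i hi
        obtain ⟨u, hu, h⟩ := ih _ hi
        refine ⟨φ i u, map_mem hE i hu, ?_⟩
        rw [hf i u hu, pow_succ]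
        rw [abs_le] at h ⊢
        constructor <;> linarith
      rcases le_total t (1 / 2) with h | h
      · exact hstep 0 (by simp; constructor <;> linarith)
      · exact hstep 1 (by simp; constructor <;> linarith)
  have himage : Icc (0 : ℝ) 1 ⊆ f '' E := by
    have hclosed : IsClosed (f '' E) :=
      (hEc.image_of_continuousOn (hhol.continuousOn (by norm_num))).isClosed
    intro t ht
    rw [← hclosed.closure_eq, Metric.mem_closure_iff]
    intro ε hε
    obtain ⟨n, hn⟩ := exists_pow_lt_of_lt_one hε (by norm_num : (1 / 2 : ℝ) < 1)
    obtain ⟨u, hu, h⟩ := hdense n t ht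
    exact ⟨f u, mem_image_of_mem _ hu, by rw [dist_comm, Real.dist_eq]; exact h.trans_lt hn⟩
  have h1 : dimH (Icc (0 : ℝ) 1) = 1 := by
    rw [Real.dimH_of_nonempty_interior (by simp)]
    simp
  have h2 : 1 ≤ dimH E / ((1 / 2 : NNReal) : ENNReal) :=
    h1.symm.le.trans ((dimH_mono himage).trans (hhol.dimH_image_le (by norm_num)))
  rw [ENNReal.le_div_iff_mul_le (by simp) (by simp)] at h2
  simpa using h2

end Pair

theorem exists_abs_sub_le_of_small_steps {y : ℕ → ℝ} {s η : ℝ}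
    (hstep : ∀ k, |y (k + 1) - y k| ≤ η) (h0 : y 0 ≤ s) (htop : Tendsto y atTop atTop) :
    ∃ k, |y k - s| ≤ η := by
  classical
  have hex : ∃ k, s ≤ y k := (htop.eventually_ge_atTop s).exists
  have hη : 0 ≤ η := (abs_nonneg _).trans (hstep 0)
  rcases h : Nat.find hex with _ | k
  · have := Nat.find_spec hex
    rw [h] at this
    exact ⟨0, by rw [le_antisymm h0 this]; simpa using hη⟩
  · have h1 := Nat.find_spec hex
    rw [h] at h1
    have h2 : y k < s := not_le.1 (Nat.find_min hex (m := k) (by omega))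
    have h3 := (abs_le.1 (hstep k)).2
    exact ⟨k + 1, abs_le.2 ⟨by linarith, by linarith⟩⟩

section Linear

variable {X : Type*} [NormedAddCommGroup X] [NormedSpace ℝ X]

theorem pow_add_apply (P : X →ₗᵢ[ℝ] X) (m n : ℕ) (w : X) :
    (P ^ (m + n)) w = (P ^ m) ((P ^ n) w) := by
  rw [pow_add]
  rfl

/-- Simultaneous recurrence of the powers of a linear isometry and the multiples of a real number
modulo one. -/
theorem exists_pow_near_one_and_mul_near_int [FiniteDimensional ℝ X] (P : X →ₗᵢ[ℝ] X) (θ : ℝ)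
    {ε : ℝ} (hε : 0 < ε) :
    ∃ q : ℕ, 0 < q ∧ ∃ p : ℤ, |q * θ - p| ≤ ε ∧ ∀ w, ‖(P ^ q) w - w‖ ≤ ε * ‖w‖ := by
  let z : ℕ → (X →L[ℝ] X) × ℝ := fun n => ((P ^ n).toContinuousLinearMap, Int.fract (n * θ))
  have hz : ∀ n, z n ∈ Metric.closedBall (0 : X →L[ℝ] X) 1 ×ˢ Icc (0 : ℝ) 1 := fun n =>
    ⟨by simpa using (P ^ n).norm_toContinuousLinearMap_le,
      (Int.fract_nonneg _), (Int.fract_lt_one _).le⟩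
  have : ProperSpace (X →L[ℝ] X) := FiniteDimensional.proper ℝ _
  obtain ⟨a, -, g, hg, hlim⟩ :=
    ((isCompact_closedBall (0 : X →L[ℝ] X) 1).prod isCompact_Icc).tendsto_subseq hz
  obtain ⟨N, hN⟩ := Metric.cauchySeq_iff'.1 hlim.cauchySeq ε hε
  have hlt : g N < g (N + 1) := hg N.lt_succ_self
  have hd : dist (z (g (N + 1))) (z (g N)) < ε := hN (N + 1) N.le_succ
  rw [Prod.dist_eq, max_lt_iff] at hd
  obtain ⟨q, hq⟩ := Nat.exists_eq_add_of_lt hlt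
  refine ⟨q + 1, q.succ_pos, ⌊(g (N + 1) : ℝ) * θ⌋ - ⌊(g N : ℝ) * θ⌋, ?_, fun w => ?_⟩
  · have h := hd.2.le
    simp only [z, Real.dist_eq, Int.fract] at h
    refine le_of_eq_of_le (congrArg _ ?_) h
    rw [hq]
    push_cast
    ring
  · have h := (((z (g (N + 1))).1 - (z (g N)).1).le_opNorm w).trans
      (mul_le_mul_of_nonneg_right (dist_eq_norm (z (g (N + 1))).1 (z (g N)).1 ▸ hd.1.le)
        (norm_nonneg w))
    have heq : ((z (g (N + 1))).1 - (z (g N)).1) w = (P ^ g N) ((P ^ (q + 1)) w - w) := by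
      rw [map_sub, ← pow_add_apply, ← add_assoc, ← hq]
      rfl
    rwa [heq, LinearIsometry.norm_map] at h

theorem abs_log_sub_log_le {a b κ m : ℝ} (hm : 0 < m) (ha : m ≤ a) (hb : m ≤ b)
    (hab : |a - b| ≤ κ * m) : |Real.log a - Real.log b| ≤ κ := by
  have key : ∀ a b : ℝ, m ≤ a → m ≤ b → |a - b| ≤ κ * m → Real.log a - Real.log b ≤ κ := by
    intro a b ha hb hab
    have ha0 := hm.trans_le ha
    have hb0 := hm.trans_le hb
    have hκ : 0 ≤ κ := nonneg_of_mul_nonneg_left ((abs_nonneg _).trans hab) hm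
    rw [← Real.log_div ha0.ne' hb0.ne']
    refine (Real.log_le_sub_one_of_pos (div_pos ha0 hb0)).trans ?_
    rw [sub_le_iff_le_add, div_le_iff₀ hb0]
    nlinarith [(abs_le.1 hab).2]
  refine abs_le.2 ⟨?_, key a b ha hb hab⟩
  linarith [key b a hb ha (abs_sub_comm a b ▸ hab)]

/-- If `α / L` is irrational, then `log ‖M (P ^ n v)‖ + n α` is dense modulo `L`. -/
theorem exists_abs_log_norm_add_sub_le [FiniteDimensional ℝ X] (P : X →ₗᵢ[ℝ] X) (M : X ≃ₗ[ℝ] X)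
    {v : X} (hv : v ≠ 0) {α L : ℝ} (hL : L ≠ 0) (hirr : Irrational (α / L)) (s : ℝ) {η : ℝ}
    (hη : 0 < η) : ∃ n : ℕ, ∃ k : ℤ, |Real.log ‖M ((P ^ n) v)‖ + n * α + k * L - s| ≤ η := by
  let M' := M.toContinuousLinearEquiv
  obtain ⟨C, hC0, hC⟩ := (M' : X →L[ℝ] X).isBoundedLinearMap.bound
  obtain ⟨C', hC'0, hC'⟩ := (M'.symm : X →L[ℝ] X).isBoundedLinearMap.bound
  have hC : ∀ w, ‖M w‖ ≤ C * ‖w‖ := hC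
  have hC' : ∀ w, ‖w‖ / C' ≤ ‖M w‖ := by
    intro w
    rw [div_le_iff₀' hC'0]
    simpa [M'] using hC' (M w)
  have hv0 : 0 < ‖v‖ := norm_pos_iff.2 hv
  have hlow : ∀ n, ‖v‖ / C' ≤ ‖M ((P ^ n) v)‖ := fun n => by
    simpa using hC' ((P ^ n) v)
  have hup : ∀ n, ‖M ((P ^ n) v)‖ ≤ C * ‖v‖ := fun n => by
    simpa using hC ((P ^ n) v)
  have hm : 0 < ‖v‖ / C' := div_pos hv0 hC'0
  have hden : 0 < C * C' + |L| := by positivity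
  obtain ⟨q, hq, p, hqp, hPq⟩ :=
    exists_pow_near_one_and_mul_near_int P (α / L) (div_pos hη hden)
  set ε := η / (C * C' + |L|) with hε
  have hεη : ε * (C * C') + ε * |L| = η := by
    rw [← mul_add, hε, div_mul_cancel₀ _ hden.ne']
  set δ := q * α - p * L with hδ
  have hδeq : δ = (q * (α / L) - p) * L := by
    rw [hδ]
    field_simp
  have hδle : |δ| ≤ ε * |L| := by
    rw [hδeq, abs_mul]
    exact mul_le_mul_of_nonneg_right hqp (abs_nonneg L)
  have hδ0 : δ ≠ 0 := by
    rw [hδeq]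
    refine mul_ne_zero (sub_ne_zero.2 ?_) hL
    exact ((hirr.natCast_mul hq.ne').ne_int p)
  let x : ℕ → ℝ := fun k => Real.log ‖M ((P ^ (q * k)) v)‖ + k * δ
  have hstep : ∀ k, |x (k + 1) - x k| ≤ η := by
    intro k
    have h1 : |Real.log ‖M ((P ^ (q * (k + 1))) v)‖ - Real.log ‖M ((P ^ (q * k)) v)‖|
        ≤ ε * (C * C') := by
      refine abs_log_sub_log_le hm (hlow _) (hlow _) ((abs_norm_sub_norm_le _ _).trans ?_)
      rw [← map_sub]
      refine (hC _).trans ?_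
      have h2 : (P ^ (q * (k + 1))) v = (P ^ q) ((P ^ (q * k)) v) := by
        rw [← pow_add_apply, mul_add_one, add_comm]
      have h3 := hPq ((P ^ (q * k)) v)
      rw [← h2, LinearIsometry.norm_map] at h3
      calc C * _ ≤ C * (ε * ‖v‖) := mul_le_mul_of_nonneg_left h3 hC0.le
        _ = ε * (C * C') * (‖v‖ / C') := by field_simp
    have h4 : x (k + 1) - x k = (Real.log ‖M ((P ^ (q * (k + 1))) v)‖
        - Real.log ‖M ((P ^ (q * k)) v)‖) + δ := by
      simp only [x]
      push_cast
      ring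
    rw [h4]
    exact (abs_add_le _ _).trans (by linarith)
  have hconv : ∀ k : ℕ, ∀ j : ℤ, x k + j * L =
      Real.log ‖M ((P ^ (q * k)) v)‖ + (q * k : ℕ) * α + ((j - k * p : ℤ) : ℝ) * L := by
    intro k j
    simp only [x, hδ]
    push_cast
    ring
  have hlogC : ∀ n, Real.log ‖M ((P ^ n) v)‖ ≤ Real.log (C * ‖v‖) := fun n =>
    Real.log_le_log (hm.trans_le (hlow n)) (hup n)
  have hlogC' : ∀ n, Real.log (‖v‖ / C') ≤ Real.log ‖M ((P ^ n) v)‖ := fun n =>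
    Real.log_le_log hm (hlow n)
  have hshift : ∀ t : ℝ, ∃ j : ℤ, t ≤ j * L := by
    intro t
    rcases hL.lt_or_gt with h | h
    · refine ⟨⌊t / L⌋, ?_⟩
      rw [← le_div_iff_of_neg h]
      exact Int.floor_le _
    · refine ⟨⌈t / L⌉, ?_⟩
      rw [← div_le_iff₀ h]
      exact Int.le_ceil _
  rcases hδ0.lt_or_gt with hneg | hpos
  · obtain ⟨j, hj⟩ := hshift (s - x 0)
    have htop : Tendsto (fun k => -(x k + j * L)) atTop atTop := by
      refine tendsto_atTop_mono (f := fun k : ℕ => k * (-δ) + (-Real.log (C * ‖v‖) - j * L))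
        (fun k => ?_) ?_
      · have := hlogC (q * k)
        simp only [x]
        linarith
      · exact tendsto_atTop_add_const_right _ _
          (tendsto_natCast_atTop_atTop.atTop_mul_const (neg_pos.2 hneg))
    obtain ⟨k, hk⟩ := exists_abs_sub_le_of_small_steps (s := -s) (η := η)
      (fun k => by
        rw [← abs_neg]
        convert hstep k using 2
        ring) (by linarith) htop
    refine ⟨q * k, j - k * p, ?_⟩
    rw [← hconv, ← abs_neg]
    convert hk using 2
    ring
  · obtain ⟨j, hj⟩ := hshift (x 0 - s)
    have htop : Tendsto (fun k => x k + (-j : ℤ) * L) atTop atTop := by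
      refine tendsto_atTop_mono (f := fun k : ℕ => k * δ + (Real.log (‖v‖ / C') + (-j : ℤ) * L))
        (fun k => ?_) ?_
      · have := hlogC' (q * k)
        simp only [x]
        linarith
      · exact tendsto_atTop_add_const_right _ _
          (tendsto_natCast_atTop_atTop.atTop_mul_const hpos)
    obtain ⟨k, hk⟩ := exists_abs_sub_le_of_small_steps (s := s) (η := η)
      (fun k => by
        convert hstep k using 2
        ring) (by push_cast; linarith) htop
    exact ⟨q * k, -j - k * p, by rwa [← hconv]⟩

/-- A similitude of a strictly convex space has a linear part. -/
theorem exists_linearIsometry_of_dist_eq [StrictConvexSpace ℝ X] {ψ : X → X} {γ : ℝ} (hγ : 0 < γ)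
    (hψ : ∀ x y, dist (ψ x) (ψ y) = γ * dist x y) :
    ∃ P : X →ₗᵢ[ℝ] X, ∀ x y, ψ x - ψ y = γ • P (x - y) := by
  have hiso : Isometry fun x => γ⁻¹ • ψ x := Isometry.of_dist_eq fun x y => by
    rw [dist_smul₀, hψ, Real.norm_of_nonneg (inv_nonneg.2 hγ.le), inv_mul_cancel_left₀ hγ.ne']
  let A := hiso.affineIsometryOfStrictConvexSpace
  have hA : ∀ x, A x = γ⁻¹ • ψ x := fun x => rfl
  refine ⟨A.linearIsometry, fun x y => ?_⟩
  have h := A.map_vsub x y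
  rw [hA, hA] at h
  simp only [vsub_eq_sub] at h
  rw [h, ← smul_sub, smul_inv_smul₀ hγ.ne']

theorem iterate_sub_iterate {ψ : X → X} {γ : ℝ} {P : X →ₗᵢ[ℝ] X}
    (hP : ∀ x y, ψ x - ψ y = γ • P (x - y)) (x y : X) (n : ℕ) :
    ψ^[n] x - ψ^[n] y = γ ^ n • (P ^ n) (x - y) := by
  induction n with
  | zero => simp
  | succ n ih =>
    rw [Function.iterate_succ_apply', Function.iterate_succ_apply', hP, ih, map_smul, smul_smul,
      ← pow_succ', add_comm n 1, pow_add_apply, pow_one]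

end Linear

end SelfSimilar

open SelfSimilar

theorem stmt19 (d m : ℕ) (hm : 0 < m)
    -- the IFS Φ of two contracting similitudes with common ratio ρ, attractor E
    (φ : Fin 2 → EuclideanSpace ℝ (Fin d) → EuclideanSpace ℝ (Fin d))
    (ρ : ℝ) (hρ0 : 0 < ρ) (hρ1 : ρ < 1)
    (hφ : ∀ i x y, dist (φ i x) (φ i y) = ρ * dist x y)
    (E : Set (EuclideanSpace ℝ (Fin d))) (hEc : IsCompact E) (hEne : E.Nonempty)
    (hEattr : E = ⋃ i, φ i '' E)
    (hEnontriv : ¬ E.Subsingleton)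
    (hssc : Pairwise fun i j => Disjoint (φ i '' E) (φ j '' E))
    -- the IFS Ψ of contracting similitudes with ratios γ j, attractor F
    (ψ : Fin m → EuclideanSpace ℝ (Fin d) → EuclideanSpace ℝ (Fin d))
    (γ : Fin m → ℝ) (hγ : ∀ j, 0 < γ j ∧ γ j < 1)
    (hψ : ∀ j x y, dist (ψ j x) (ψ j y) = γ j * dist x y)
    (F : Set (EuclideanSpace ℝ (Fin d))) (hFc : IsCompact F) (hFne : F.Nonempty)
    (hFattr : F = ⋃ j, ψ j '' F)
    (hFnontriv : ¬ F.Subsingleton)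
    -- dimension assumption
    (hdim : dimH E < 1 / 4)
    -- affine embedding of F into E
    (M : EuclideanSpace ℝ (Fin d) ≃ₗ[ℝ] EuclideanSpace ℝ (Fin d))
    (b : EuclideanSpace ℝ (Fin d))
    (hembed : (fun x => M x + b) '' F ⊆ E) :
    ∀ j : Fin m, ∃ t : ℚ, Real.log (γ j) / Real.log ρ = (t : ℝ) := by
  intro j
  by_contra hrat
  have hirr : Irrational (Real.log (γ j) / Real.log ρ) := by
    rintro ⟨t, ht⟩
    exact hrat ⟨t, ht.symm⟩
  obtain ⟨hγ0, -⟩ := hγ j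
  have hρ4 : ρ < 1 / 4 := by
    by_contra! h
    have h1 := (half_le_dimH h hρ1 hφ hEattr hEc hEne hssc).trans_lt hdim
    exact absurd h1 (not_lt.2 (ENNReal.div_le_div_left (by norm_num) 1))
  obtain ⟨c, hc0, hc⟩ := exists_gap hEc hφ hssc
  obtain ⟨x, hx, y, hy, hxy⟩ := Set.not_subsingleton_iff.1 hFnontriv
  obtain ⟨P, hP⟩ := exists_linearIsometry_of_dist_eq hγ0 (hψ j)
  have hiter : ∀ z ∈ F, ∀ n : ℕ, (ψ j)^[n] z ∈ F := by
    intro z hz n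
    have hmaps : MapsTo (ψ j) F F := fun w hw => by
      rw [hFattr]
      exact mem_iUnion.2 ⟨j, mem_image_of_mem _ hw⟩
    exact hmaps.iterate n hz
  have hmem : ∀ n : ℕ, γ j ^ n * ‖M ((P ^ n) (x - y))‖ ∈ distSet E := by
    intro n
    have h := dist_mem_distSet (hembed (mem_image_of_mem _ (hiter x hx n)))
      (hembed (mem_image_of_mem _ (hiter y hy n)))
    rwa [dist_eq_norm, add_sub_add_right_eq_sub, ← map_sub, iterate_sub_iterate hP, map_smul,
      norm_smul, Real.norm_of_nonneg (pow_nonneg hγ0.le n)] at h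
  have hsub : Iio (Real.log c) ⊆ Real.exp ⁻¹' distSet E := by
    intro s hs
    rw [← ((isClosed_distSet hEc).preimage Real.continuous_exp).closure_eq,
      Metric.mem_closure_iff]
    intro ε hε
    have hη : 0 < min (ε / 2) ((Real.log c - s) / 2) :=
      lt_min (by linarith) (by linarith [mem_Iio.1 hs])
    obtain ⟨n, k, hnk⟩ := exists_abs_log_norm_add_sub_le P M (sub_ne_zero.2 hxy)
      (Real.log_neg hρ0 hρ1).ne hirr s hη
    set r := Real.log ‖M ((P ^ n) (x - y))‖ + n * Real.log (γ j) + k * Real.log ρ with hr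
    have hr1 : |r - s| ≤ ε / 2 := hnk.trans (min_le_left _ _)
    have hr2 : |r - s| ≤ (Real.log c - s) / 2 := hnk.trans (min_le_right _ _)
    have hpos : 0 < ‖M ((P ^ n) (x - y))‖ := by
      rw [norm_pos_iff, Ne, LinearEquiv.map_eq_zero_iff, ← norm_eq_zero,
        LinearIsometry.norm_map, norm_eq_zero]
      exact sub_ne_zero.2 hxy
    have hexp : Real.exp r = ‖M ((P ^ n) (x - y))‖ * γ j ^ n * ρ ^ k := by
      rw [hr, Real.exp_add, Real.exp_add, Real.exp_log hpos, ← Real.log_pow, ← Real.log_zpow,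
        Real.exp_log (pow_pos hγ0 n), Real.exp_log (zpow_pos hρ0 k)]
    refine ⟨r, ?_, by rw [dist_comm, Real.dist_eq]; linarith⟩
    refine mem_distSet_of_zpow_mul_mem hρ0 hρ1 hφ hEattr hc (Real.exp_pos r).le ?_ (-k) ?_
    · rw [← Real.lt_log_iff_exp_lt hc0]
      have := mem_Iio.1 hs
      linarith [(abs_le.1 hr2).2]
    · convert hmem n using 1
      rw [hexp, zpow_neg]
      field_simp
  have hIoo : Ioo 0 c ⊆ distSet E := by
    rintro t ⟨ht0, htc⟩
    have := hsub (mem_Iio.2 (Real.log_lt_log ht0 htc))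
    rwa [mem_preimage, Real.exp_log ht0] at this
  have hvol := measure_mono_null hIoo
    (volume_distSet_eq_zero hφ hρ0.le hρ4 hEattr hEc hEne)
  rw [Real.volume_Ioo, ENNReal.ofReal_eq_zero] at hvol
  linarith
end
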